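/- Let T be a planar triangulation (maximal planar graph) on V ≥ 4 vertices. Then T has at most V - 3 subgraphs isomorphic to K_4. Consequently, if G is a 3-connected cubic planar graph with n vertices, its dual triangulation G* has n/2 + 2 vertices and therefore at most n/2 - 1 subgraphs isomorphic to K_4. -/

import Mathlib

/-- A graph is planar if its vertices can be drawn as distinct points of the plane and its
edges as simple arcs joining their endpoints, such that two distinct edges only meet in
common endpoints and no arc passes through another vertex. -/
def IsPlanar {V : Type*} (G : SimpleGraph V) : Prop :=
  ∃ f : V → ℝ × ℝ, Function.Injective f ∧
    ∃ γ : ∀ ⦃u v : V⦄, G.Adj u v → Path (f u) (f v),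
      (∀ ⦃u v : V⦄ (h : G.Adj u v), Function.Injective (γ h)) ∧
      (∀ ⦃u v u' v' : V⦄ (h : G.Adj u v) (h' : G.Adj u' v'),
        s(u, v) ≠ s(u', v') →
        Set.range (γ h) ∩ Set.range (γ h') ⊆ ({f u, f v} : Set (ℝ × ℝ)) ∩ {f u', f v'}) ∧
      (∀ ⦃u v : V⦄ (h : G.Adj u v) (w : V), f w ∈ Set.range (γ h) → w = u ∨ w = v)

/-- The increment along `α : [0, 1] → ℂ` of a continuous branch of `log (α t - w)`. -/
noncomputable def logIncrement (α : ℝ → ℂ) (w : ℂ) : ℂ :=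
  open Classical in
  if h : ∃ g : ℝ → ℂ, Continuous g ∧ ∀ t, Complex.exp (g t) = α t - w then
    h.choose 1 - h.choose 0
  else 0

lemma sub_eq_sub_of_exp_eq_mul {g h : ℝ → ℂ} (hg : Continuous g) (hh : Continuous h) {c : ℂ}
    (hc : ∀ t, Complex.exp (g t) = c * Complex.exp (h t)) (s t : ℝ) :
    g s - g t = h s - h t := by
  have key : (fun t ↦ g t - h t) = fun _ ↦ g 0 - h 0 := by
    refine Complex.isCoveringMap_exp.eq_of_comp_eq (hg.sub hh) continuous_const ?_ 0 rfl
    funext t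
    simp [Complex.exp_sub, hc]
  linear_combination congrFun key s - congrFun key t

lemma logIncrement_eq {α g : ℝ → ℂ} {w c : ℂ} (hg : Continuous g)
    (h : ∀ t, Complex.exp (g t) = c * (α t - w)) : logIncrement α w = g 1 - g 0 := by
  have hc : c ≠ 0 := by
    rintro rfl
    simpa using h 0
  have hex : ∃ g : ℝ → ℂ, Continuous g ∧ ∀ t, Complex.exp (g t) = α t - w :=
    ⟨fun t ↦ g t - Complex.log c, by fun_prop, fun t ↦ by
      rw [Complex.exp_sub, h, Complex.exp_log hc, mul_div_cancel_left₀ _ hc]⟩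
  rw [logIncrement, dif_pos hex]
  refine (sub_eq_sub_of_exp_eq_mul hg hex.choose_spec.1 (c := c) (fun t ↦ ?_) 1 0).symm
  rw [h, hex.choose_spec.2]

lemma exists_exp_eq_sub {α β : ℝ → ℂ} (hα : Continuous α) (hβ : Continuous β)
    (hne : ∀ s t, α s ≠ β t) :
    ∃ L : ℝ × ℝ → ℂ, Continuous L ∧ ∀ s t, Complex.exp (L (s, t)) = α s - β t := by
  obtain ⟨F, ⟨-, hF⟩, -⟩ := Complex.isCoveringMapOn_exp.existsUnique_continuousMap_lifts
    (⟨fun x ↦ α x.1 - β x.2, by fun_prop⟩ : C(ℝ × ℝ, ℂ)) (a₀ := (0, 0))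
    (e₀ := Complex.log (α 0 - β 0)) (Complex.exp_log (sub_ne_zero.2 (hne 0 0)))
    (fun x ↦ by simpa [sub_eq_zero] using hne x.1 x.2)
  exact ⟨F, F.continuous, fun s t ↦ congrFun hF (s, t)⟩

lemma exp_logIncrement {α : ℝ → ℂ} (hα : Continuous α) {w : ℂ} (hw : ∀ t, α t ≠ w) :
    Complex.exp (logIncrement α w) * (α 0 - w) = α 1 - w := by
  obtain ⟨L, hL, h⟩ := exists_exp_eq_sub hα (continuous_const (y := w)) (fun s _ ↦ hw s)
  rw [logIncrement_eq (g := fun s ↦ L (s, 0)) (c := 1) (by fun_prop) (by simp [h]),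
    Complex.exp_sub, ← h 0 0, ← h 1 0, div_mul_cancel₀ _ (Complex.exp_ne_zero _)]

lemma logIncrement_sub_logIncrement {α β : ℝ → ℂ} (hα : Continuous α) (hβ : Continuous β)
    (hne : ∀ s t, α s ≠ β t) :
    logIncrement α (β 0) - logIncrement α (β 1) = logIncrement β (α 0) - logIncrement β (α 1) := by
  obtain ⟨L, hL, h⟩ := exists_exp_eq_sub hα hβ hne
  have hl (t : ℝ) : logIncrement α (β t) = L (1, t) - L (0, t) :=
    logIncrement_eq (g := fun s ↦ L (s, t)) (c := 1) (by fun_prop) (by simp [h])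
  have hr (s : ℝ) : logIncrement β (α s) = L (s, 1) - L (s, 0) :=
    logIncrement_eq (g := fun t ↦ L (s, t)) (c := -1) (by fun_prop) (by simp [h])
  rw [hl, hl, hr, hr]
  ring

/-- There is no map of `K₅` to the plane under which disjoint edges have disjoint images;
edges sharing a vertex may intersect arbitrarily. -/
theorem not_disjoint_edges_five (p : Fin 5 → ℂ) (γ : Fin 5 → Fin 5 → ℝ → ℂ)
    (hγ : ∀ i j, i < j → Continuous (γ i j)) (h0 : ∀ i j, i < j → γ i j 0 = p i)
    (h1 : ∀ i j, i < j → γ i j 1 = p j)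
    (hdisj : ∀ i j k l, i < j → k < l → i < k → j ≠ k → j ≠ l → ∀ s t, γ i j s ≠ γ k l t) :
    False := by
  have hdisj' (i j k l : Fin 5) (hij : i < j) (hkl : k < l) (hik : i ≠ k) (hil : i ≠ l)
      (hjk : j ≠ k) (hjl : j ≠ l) (s t : ℝ) : γ i j s ≠ γ k l t := by
    rcases lt_or_gt_of_ne hik with h | h
    · exact hdisj i j k l hij hkl h hjk hjl s t
    · exact (hdisj k l i j hkl hij h hil.symm hjl.symm t s).symm
  have havoid (i j w : Fin 5) (hij : i < j) (hi : i ≠ w) (hj : j ≠ w) (s : ℝ) :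
      γ i j s ≠ p w := by
    obtain ⟨x, hxi, hxj, hxw⟩ : ∃ x, x ≠ i ∧ x ≠ j ∧ x ≠ w := by
      revert i j w
      decide
    rcases lt_or_gt_of_ne hxw with h | h
    · rw [← h1 x w h]
      exact hdisj' i j x w hij h hxi.symm hi hxj.symm hj s 1
    · rw [← h0 w x h]
      exact hdisj' i j w x hij h hi hxi.symm hj hxj.symm s 0
  have hp (i j : Fin 5) (hij : i ≠ j) : p i ≠ p j := by
    obtain ⟨x, hxi, hxj⟩ : ∃ x, x ≠ i ∧ x ≠ j := by
      revert i j
      decide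
    rcases lt_or_gt_of_ne hxi with h | h
    · rw [← h1 x i h]
      exact havoid x i j h hxj hij 1
    · rw [← h0 i x h]
      exact havoid i x j h hij hxj 0
  let l (i j : Fin 5) : ℂ :=
    if i < j then Complex.log (p i - p j) else Complex.log (p j - p i) + Real.pi * Complex.I
  have hl (i j : Fin 5) (hij : i ≠ j) : Complex.exp (l i j) = p i - p j := by
    simp only [l]
    split_ifs
    · rw [Complex.exp_log (sub_ne_zero.2 (hp i j hij))]
    · rw [Complex.exp_add, Complex.exp_log (sub_ne_zero.2 (hp j i hij.symm)), Complex.exp_pi_mul_I]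
      ring
  let σ (i j : Fin 5) : ℤ := if i < j then -1 else 1
  have hσ (i j : Fin 5) (hij : i ≠ j) : l i j - l j i = Real.pi * Complex.I * σ i j := by
    rcases lt_or_gt_of_ne hij with h | h <;> simp [l, σ, h, h.not_gt]
  have hn (i j w : Fin 5) : ∃ n : ℤ, i < j → i ≠ w → j ≠ w →
      logIncrement (γ i j) (p w) = l j w - l i w + n * (2 * Real.pi * Complex.I) := by
    by_cases hij : i < j ∧ i ≠ w ∧ j ≠ w
    · obtain ⟨hij, hi, hj⟩ := hij
      have h := exp_logIncrement (hγ i j hij) (havoid i j w hij hi hj)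
      rw [h0 i j hij, h1 i j hij, ← hl i w hi, ← hl j w hj] at h
      have h' : Complex.exp (logIncrement (γ i j) (p w)) = Complex.exp (l j w - l i w) := by
        rw [Complex.exp_sub, ← h, mul_div_cancel_right₀ _ (Complex.exp_ne_zero _)]
      obtain ⟨n, hn⟩ := Complex.exp_eq_exp_iff_exists_int.1 h'
      exact ⟨n, fun _ _ _ ↦ hn⟩
    · exact ⟨0, fun a b c ↦ (hij ⟨a, b, c⟩).elim⟩
  choose n hn using hn
  have key (i j k m : Fin 5) (hij : i < j) (hkm : k < m) (hik : i ≠ k) (him : i ≠ m)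
      (hjk : j ≠ k) (hjm : j ≠ m) :
      σ j k - σ i k - σ j m + σ i m + 2 * (n i j k - n i j m - n k m i + n k m j) = 0 := by
    have h := logIncrement_sub_logIncrement (hγ i j hij) (hγ k m hkm)
      (hdisj' i j k m hij hkm hik him hjk hjm)
    rw [h0 k m hkm, h1 k m hkm, h0 i j hij, h1 i j hij, hn i j k hij hik hjk,
      hn i j m hij him hjm, hn k m i hkm hik.symm him.symm,
      hn k m j hkm hjk.symm hjm.symm] at h
    have hpi : (Real.pi * Complex.I : ℂ) ≠ 0 := by simp [Real.pi_ne_zero]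
    have h' : (Real.pi * Complex.I : ℂ) * (σ j k - σ i k - σ j m + σ i m +
        2 * (n i j k - n i j m - n k m i + n k m j)) = 0 := by
      linear_combination h - hσ j k hjk + hσ i k hik + hσ j m hjm - hσ i m him
    exact_mod_cast (mul_eq_zero.1 h').resolve_left hpi
  have e₁ := key 0 1 2 3 (by decide) (by decide) (by decide) (by decide) (by decide) (by decide)
  have e₂ := key 0 2 1 3 (by decide) (by decide) (by decide) (by decide) (by decide) (by decide)
  have e₃ := key 0 3 1 2 (by decide) (by decide) (by decide) (by decide) (by decide) (by decide)
  have e₄ := key 0 1 2 4 (by decide) (by decide) (by decide) (by decide) (by decide) (by decide)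
  have e₅ := key 0 2 1 4 (by decide) (by decide) (by decide) (by decide) (by decide) (by decide)
  have e₆ := key 0 4 1 2 (by decide) (by decide) (by decide) (by decide) (by decide) (by decide)
  have e₇ := key 0 1 3 4 (by decide) (by decide) (by decide) (by decide) (by decide) (by decide)
  have e₈ := key 0 3 1 4 (by decide) (by decide) (by decide) (by decide) (by decide) (by decide)
  have e₉ := key 0 4 1 3 (by decide) (by decide) (by decide) (by decide) (by decide) (by decide)
  have e₁₀ := key 0 2 3 4 (by decide) (by decide) (by decide) (by decide) (by decide) (by decide)
  have e₁₁ := key 0 3 2 4 (by decide) (by decide) (by decide) (by decide) (by decide) (by decide)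
  have e₁₂ := key 0 4 2 3 (by decide) (by decide) (by decide) (by decide) (by decide) (by decide)
  have e₁₃ := key 1 2 3 4 (by decide) (by decide) (by decide) (by decide) (by decide) (by decide)
  have e₁₄ := key 1 3 2 4 (by decide) (by decide) (by decide) (by decide) (by decide) (by decide)
  have e₁₅ := key 1 4 2 3 (by decide) (by decide) (by decide) (by decide) (by decide) (by decide)
  simp [σ] at e₁ e₂ e₃ e₄ e₅ e₆ e₇ e₈ e₉ e₁₀ e₁₁ e₁₂ e₁₃ e₁₄ e₁₅
  omega

/-- In a planar graph, no connected set disjoint from a 4-clique `s` is adjacent to all four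
vertices of `s`: otherwise contracting it would give a `K₅`. -/
theorem IsPlanar.exists_not_adj_of_isNClique_four {V : Type*} {G : SimpleGraph V}
    (hG : IsPlanar G) {s : Finset V} (hs : G.IsNClique 4 s) {e : V} (he : e ∉ s) :
    ∃ a ∈ s, ∀ v, Relation.ReflTransGen (fun u v ↦ G.Adj u v ∧ v ∉ s) e v → ¬ G.Adj v a := by
  by_contra! hcon
  obtain ⟨f, hf, γ, -, hγ, hγf⟩ := hG
  let K (t : Set V) : Set (ℝ × ℝ) :=
    {z | ∃ x ∈ t, ∃ y ∈ t, ∃ h : G.Adj x y, z ∈ Set.range (γ h)}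
  have hK {t t' : Set V} (h : t ⊆ t') : K t ⊆ K t' := by
    rintro z ⟨x, hx, y, hy, hz⟩
    exact ⟨x, h hx, y, h hy, hz⟩
  have hdisj {u v x y : V} (h : G.Adj u v) (h' : G.Adj x y) (hux : u ≠ x) (huy : u ≠ y)
      (hvx : v ≠ x) (hvy : v ≠ y) : Disjoint (Set.range (γ h)) (Set.range (γ h')) := by
    refine Set.disjoint_left.2 fun z hz hz' ↦ ?_
    rcases hγ h h' (by simp [hux, huy]) ⟨hz, hz'⟩ with ⟨rfl | rfl, h | h⟩
    exacts [hux (hf h), huy (hf h), hvx (hf h), hvy (hf h)]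
  have hedge {t : Set V} {u v : V} (h : G.Adj u v) (hu : u ∉ t) (hv : v ∉ t) :
      JoinedIn (K t)ᶜ (f u) (f v) := by
    refine ⟨γ h, fun r ↦ ?_⟩
    rintro ⟨x, hx, y, hy, hxy, hr⟩
    refine Set.disjoint_left.1 (hdisj h hxy ?_ ?_ ?_ ?_) ⟨r, rfl⟩ hr <;> rintro rfl <;>
      contradiction
  have hreach {v : V} (h : Relation.ReflTransGen (fun u v ↦ G.Adj u v ∧ v ∉ s) e v) :
      v ∉ s ∧ JoinedIn (K s)ᶜ (f e) (f v) := by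
    induction h with
    | refl =>
      refine ⟨he, JoinedIn.refl ?_⟩
      rintro ⟨x, hx, y, hy, hxy, hr⟩
      rcases hγf hxy e hr with rfl | rfl
      exacts [he hx, he hy]
    | tail _ h ih => exact ⟨h.2, ih.2.trans (hedge h.1 ih.1 h.2)⟩
  have hjoin (a : s) : JoinedIn (K (s \ {a.1}))ᶜ (f e) (f a) := by
    obtain ⟨v, hv, hva⟩ := hcon a a.2
    refine ((hreach hv).2.mono (Set.compl_subset_compl.2 (hK Set.sdiff_subset))).trans
      (hedge hva (fun h ↦ (hreach hv).1 h.1) (fun h ↦ h.2 rfl))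
  let q : Fin 4 ≃ s := (Finset.equivFinOfCardEq hs.card_eq).symm
  have hadj (i j : Fin 4) (hij : i < j) : G.Adj (q i) (q j) :=
    hs.isClique (q i).2 (q j).2 fun h ↦ hij.ne (q.injective (Subtype.ext h))
  have hmem (i j : Fin 4) (h : i < j) (t : ℝ) :
      (γ (hadj i j h)).extend t ∈ Set.range (γ (hadj i j h)) :=
    Set.mem_range_self (Set.projIcc 0 1 zero_le_one t)
  let φ : ℝ × ℝ → ℂ := Complex.equivRealProdCLM.symm
  have hφ : Continuous φ := Complex.equivRealProdCLM.symm.continuous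
  have hφi : Function.Injective φ := Complex.equivRealProdCLM.symm.injective
  let E (i j : Fin 4) : ℝ → ℂ := fun r ↦
    if h : i < j then φ ((γ (hadj i j h)).extend r) else 0
  refine not_disjoint_edges_five (Fin.cons (φ (f e)) fun i ↦ φ (f (q i)))
    (Fin.cons (Fin.cons 0 fun i r ↦ φ ((hjoin (q i)).somePath.extend r))
      fun i ↦ Fin.cons 0 (E i)) ?_ ?_ ?_ ?_
  · refine Fin.cases (Fin.cases (by simp) fun j _ ↦ ?_) fun i ↦ Fin.cases (by simp) fun j hij ↦ ?_
    · simpa [Function.comp_def] using hφ.comp (hjoin (q j)).somePath.continuous_extend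
    · rw [Fin.succ_lt_succ_iff] at hij
      simpa [E, hij, Function.comp_def] using hφ.comp (γ (hadj i j hij)).continuous_extend
  · refine Fin.cases (Fin.cases (by simp) fun j _ ↦ ?_) fun i ↦ Fin.cases (by simp) fun j hij ↦ ?_
    · simp
    · rw [Fin.succ_lt_succ_iff] at hij
      simp [E, hij]
  · refine Fin.cases (Fin.cases (by simp) fun j _ ↦ ?_) fun i ↦ Fin.cases (by simp) fun j hij ↦ ?_
    · simp
    · rw [Fin.succ_lt_succ_iff] at hij
      simp [E, hij]
  · intro i j k l
    cases j using Fin.cases with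
    | zero => simp
    | succ j =>
    cases k using Fin.cases with
    | zero => simp
    | succ k =>
    cases l using Fin.cases with
    | zero => simp
    | succ l =>
    cases i using Fin.cases with
    | zero =>
      intro _ hkl _ hjk hjl r t
      rw [Fin.succ_lt_succ_iff] at hkl
      rw [Ne, Fin.succ_inj] at hjk hjl
      simp only [Fin.cons_zero, Fin.cons_succ, E, hkl, dif_pos]
      refine fun h ↦ (hjoin (q j)).somePath_mem (Set.projIcc 0 1 zero_le_one r) ⟨q k, ⟨(q k).2, ?_⟩,
        q l, ⟨(q l).2, ?_⟩, hadj k l hkl, ?_⟩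
      · exact fun h ↦ hjk (q.injective (Subtype.ext h)).symm
      · exact fun h ↦ hjl (q.injective (Subtype.ext h)).symm
      · exact hφi h ▸ hmem k l hkl t
    | succ i =>
      intro hij hkl hik hjk hjl r t
      rw [Fin.succ_lt_succ_iff] at hij hkl hik
      rw [Ne, Fin.succ_inj] at hjk hjl
      simp only [Fin.cons_succ, E, hij, hkl, dif_pos]
      have hq {x y : Fin 4} (h : x ≠ y) : (q x : V) ≠ q y :=
        fun h' ↦ h (q.injective (Subtype.ext h'))
      exact fun h ↦ Set.disjoint_left.1 (hdisj (hadj i j hij) (hadj k l hkl) (hq hik.ne)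
        (hq (hik.trans hkl).ne) (hq hjk) (hq hjl)) (hmem i j hij r) (hφi h ▸ hmem k l hkl t)

/-- A vertex set `S` of size at least three in a planar graph spans at most `#S - 3` copies
of `K₄`. -/
theorem IsPlanar.card_isNClique_four_add_three_le {V : Type*} {G : SimpleGraph V}
    (hG : IsPlanar G) (S : Finset V) (hS : 3 ≤ S.card) :
    {s : Finset V | s ⊆ S ∧ G.IsNClique 4 s}.ncard + 3 ≤ S.card := by
  classical
  induction S using Finset.strongInduction with
  | H S ih =>
  rcases Set.eq_empty_or_nonempty {s : Finset V | s ⊆ S ∧ G.IsNClique 4 s} with hemp | ⟨Q, hQS, hQ⟩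
  · simpa [hemp] using hS
  by_cases hSQ : S ⊆ Q
  · have hSQ : S = Q := hSQ.antisymm hQS
    have : {s : Finset V | s ⊆ S ∧ G.IsNClique 4 s} ⊆ {Q} := by
      rintro s ⟨hs, hs'⟩
      exact Finset.eq_of_subset_of_card_le (hSQ ▸ hs) (by rw [hs'.card_eq, hQ.card_eq])
    have := Set.ncard_le_ncard this
    rw [Set.ncard_singleton] at this
    rw [hSQ, hQ.card_eq] at *
    omega
  obtain ⟨e, heS, heQ⟩ := Finset.not_subset.1 hSQ
  obtain ⟨d, hdQ, hd⟩ := hG.exists_not_adj_of_isNClique_four hQ heQ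
  let R : V → V → Prop := fun u v ↦ G.Adj u v ∧ v ∈ S \ Q
  let C := {v ∈ S \ Q | Relation.ReflTransGen R e v}
  have heC : e ∈ C := by simp [C, heS, heQ, Relation.ReflTransGen.refl]
  have hCS : C ⊆ S \ Q := Finset.filter_subset _ _
  have hCd {v : V} (hv : v ∈ C) : ¬ G.Adj v d :=
    hd v (Relation.ReflTransGen.mono (r := R) (fun _ _ h ↦ ⟨h.1, (Finset.mem_sdiff.1 h.2).2⟩)
      _ _ (Finset.mem_filter.1 hv).2)
  have hCadj {u v : V} (hu : u ∈ C) (huv : G.Adj u v) (hv : v ∈ S) : v ∈ C ∪ Q.erase d := by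
    by_cases hvQ : v ∈ Q
    · refine Finset.mem_union_right _ (Finset.mem_erase.2 ⟨?_, hvQ⟩)
      rintro rfl
      exact hCd hu huv
    · have hv' : v ∈ S \ Q := Finset.mem_sdiff.2 ⟨hv, hvQ⟩
      exact Finset.mem_union_left _
        (Finset.mem_filter.2 ⟨hv', (Finset.mem_filter.1 hu).2.tail ⟨huv, hv'⟩⟩)
  have hdC : d ∉ C ∪ Q.erase d := by
    simp only [Finset.mem_union, Finset.mem_erase, ne_eq, not_true_eq_false, false_and, or_false]
    exact fun h ↦ (Finset.mem_sdiff.1 (hCS h)).2 hdQ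
  have hcardQ : (Q.erase d).card = 3 := by rw [Finset.card_erase_of_mem hdQ, hQ.card_eq]
  have hcard₁ : (C ∪ Q.erase d).card = C.card + 3 := by
    rw [Finset.card_union_of_disjoint, hcardQ]
    exact Finset.disjoint_left.2 fun v hv hv' ↦
      (Finset.mem_sdiff.1 (hCS hv)).2 (Finset.mem_of_mem_erase hv')
  have hsub₁ : C ∪ Q.erase d ⊆ S :=
    Finset.union_subset (hCS.trans Finset.sdiff_subset) ((Finset.erase_subset _ _).trans hQS)
  have hQC : Q ⊆ S \ C := fun v hv ↦
    Finset.mem_sdiff.2 ⟨hQS hv, fun h ↦ (Finset.mem_sdiff.1 (hCS h)).2 hv⟩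
  have hcard₂ : (S \ C).card + C.card = S.card :=
    Finset.card_sdiff_add_card_eq_card (hCS.trans Finset.sdiff_subset)
  have h₁ := ih (C ∪ Q.erase d) (Finset.ssubset_iff_subset_ne.2
    ⟨hsub₁, fun h ↦ hdC (h ▸ hQS hdQ)⟩) (by omega)
  have h₂ := ih (S \ C) (Finset.ssubset_iff_subset_ne.2
    ⟨Finset.sdiff_subset, fun h ↦ (Finset.mem_sdiff.1 (h.symm.subset heS)).2 heC⟩)
    ((by simp [hQ.card_eq] : 3 ≤ Q.card).trans (Finset.card_le_card hQC))
  have hcover : {s : Finset V | s ⊆ S ∧ G.IsNClique 4 s} ⊆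
      {s | s ⊆ C ∪ Q.erase d ∧ G.IsNClique 4 s} ∪ {s | s ⊆ S \ C ∧ G.IsNClique 4 s} := by
    rintro s ⟨hs, hs'⟩
    by_cases hsC : ∃ u ∈ s, u ∈ C
    · obtain ⟨u, hus, huC⟩ := hsC
      refine Or.inl ⟨fun v hv ↦ ?_, hs'⟩
      by_cases huv : u = v
      · exact Finset.mem_union_left _ (huv ▸ huC)
      · exact hCadj huC (hs'.isClique hus hv huv) (hs hv)
    · push Not at hsC
      exact Or.inr ⟨fun v hv ↦ Finset.mem_sdiff.2 ⟨hs hv, hsC v hv⟩, hs'⟩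
  have hfin (T : Finset V) : {s : Finset V | s ⊆ T ∧ G.IsNClique 4 s}.Finite :=
    T.powerset.finite_toSet.subset fun s hs ↦ Finset.mem_coe.2 (Finset.mem_powerset.2 hs.1)
  have := (Set.ncard_le_ncard hcover ((hfin _).union (hfin _))).trans (Set.ncard_union_le _ _)
  omega

/-- A planar triangulation (maximal planar graph) on `|V| ≥ 4` vertices has at most
`|V| - 3` subgraphs isomorphic to `K₄` (4-cliques). Consequently, if it is the dual of a
3-connected cubic planar graph with `n` vertices, so that it has `n/2 + 2` vertices, then
it has at most `n/2 - 1` subgraphs isomorphic to `K₄`. -/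
theorem stmt13 {V : Type*} [Fintype V] [DecidableEq V] (T : SimpleGraph V)
    [DecidableRel T.Adj] (hV : 4 ≤ Fintype.card V)
    (hplanar : IsPlanar T)
    (hmax : ∀ H : SimpleGraph V, T ≤ H → IsPlanar H → H = T) :
    {s : Finset V | T.IsNClique 4 s}.ncard ≤ Fintype.card V - 3 ∧
    ∀ n : ℕ, Even n → Fintype.card V = n / 2 + 2 →
      {s : Finset V | T.IsNClique 4 s}.ncard ≤ n / 2 - 1 := by
  have h := hplanar.card_isNClique_four_add_three_le Finset.univ (by simpa using by omega)
  simp only [Finset.subset_univ, true_and, Finset.card_univ] at h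
  exact ⟨by omega, fun n _ hn ↦ by omega⟩
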